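/- arXiv:2105.01575 — 10 statements merged into one kernel-verified Lean document; each statement's English description precedes it below -/
import Mathlib

section
/- A natural number n is self-descriptive in base 5 if and only if n = 1425 (base-5 representation 21200); in particular 1425 is the unique self-descriptive number in base 5. -/
/-- `n` is self-descriptive in base `b`: its base-`b` digit list has length exactly `b`,
and for every `i < b`, the digit at position `i` counted from the most significant digit
(i.e. the coefficient of `b ^ (b - 1 - i)`) equals the number of occurrences of the
value `i` among the base-`b` digits of `n`. -/
def IsSelfDescriptive (b n : ℕ) : Prop :=
  (Nat.digits b n).length = b ∧
  ∀ i < b, n / b ^ (b - 1 - i) % b = (Nat.digits b n).count i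

theorem sd_aux : ∀ a b c d e : Fin 5,
    a.val = List.count 0 [e.val, d.val, c.val, b.val, a.val] →
    b.val = List.count 1 [e.val, d.val, c.val, b.val, a.val] →
    c.val = List.count 2 [e.val, d.val, c.val, b.val, a.val] →
    d.val = List.count 3 [e.val, d.val, c.val, b.val, a.val] →
    e.val = List.count 4 [e.val, d.val, c.val, b.val, a.val] →
    a.val = 2 ∧ b.val = 1 ∧ c.val = 2 ∧ d.val = 0 ∧ e.val = 0 := by
  decide +kernel

theorem selfDescriptive_base_five_iff (n : ℕ) :
    IsSelfDescriptive 5 n ↔ n = 1425 := by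
  constructor
  · rintro ⟨hl, h⟩
    have hn := Nat.ofDigits_digits 5 n
    have hd : ∀ x ∈ Nat.digits 5 n, x < 5 := fun x hx => Nat.digits_lt_base (by norm_num) hx
    generalize Nat.digits 5 n = L at *
    match L, hl with
    | [e, d, c, b, a], _ =>
      simp only [Nat.ofDigits_cons, Nat.ofDigits_nil, Nat.cast_id] at hn
      have he := hd e (by simp)
      have hdd := hd d (by simp)
      have hc := hd c (by simp)
      have hb := hd b (by simp)
      have ha := hd a (by simp)
      have h0 := h 0 (by norm_num)
      have h1 := h 1 (by norm_num)
      have h2 := h 2 (by norm_num)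
      have h3 := h 3 (by norm_num)
      have h4 := h 4 (by norm_num)
      norm_num only at h0 h1 h2 h3 h4
      have g0 : n / 625 % 5 = a := by omega
      have g1 : n / 125 % 5 = b := by omega
      have g2 : n / 25 % 5 = c := by omega
      have g3 : n / 5 % 5 = d := by omega
      have g4 : n % 5 = e := by omega
      have := sd_aux ⟨a, ha⟩ ⟨b, hb⟩ ⟨c, hc⟩ ⟨d, hdd⟩ ⟨e, he⟩
        (g0.symm.trans h0) (g1.symm.trans h1) (g2.symm.trans h2) (g3.symm.trans h3)
        (g4.symm.trans (by simpa using h4))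
      simp only at this
      omega
  · rintro rfl
    have hD : Nat.digits 5 1425 = [0, 0, 2, 1, 2] := by norm_num
    unfold IsSelfDescriptive
    rw [hD]
    decide
end

section
/- For every base b ≥ 7, the number N_b = (b−4)·b^(b−1) + 2·b^(b−2) + 1·b^(b−3) + 1·b^3 is self-descriptive in base b. -/
theorem selfDescriptive_general (b : ℕ) (hb : 7 ≤ b) :
    IsSelfDescriptive b
      ((b - 4) * b ^ (b - 1) + 2 * b ^ (b - 2) + 1 * b ^ (b - 3) + 1 * b ^ 3) := by
  obtain ⟨k, rfl⟩ : ∃ k, b = k + 7 := ⟨b - 7, by omega⟩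
  have e4 : k + 7 - 4 = k + 3 := by omega
  have e1 : k + 7 - 1 = k + 6 := by omega
  have e2 : k + 7 - 2 = k + 5 := by omega
  have e3 : k + 7 - 3 = k + 4 := by omega
  have hz : ∀ c m : ℕ, Nat.ofDigits c (List.replicate m 0) = 0 := by
    intro c m
    induction m with
    | zero => simp
    | succ m ih => simp [List.replicate_succ, Nat.ofDigits_cons, ih]
  have hN : (k + 7 - 4) * (k + 7) ^ (k + 7 - 1) + 2 * (k + 7) ^ (k + 7 - 2)
      + 1 * (k + 7) ^ (k + 7 - 3) + 1 * (k + 7) ^ 3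
      = Nat.ofDigits (k + 7) ([0, 0, 0, 1] ++ (List.replicate k 0 ++ [1, 2, k + 3])) := by
    rw [e4, e1, e2, e3, Nat.ofDigits_append, Nat.ofDigits_append, hz]
    simp only [Nat.ofDigits_cons, Nat.ofDigits_nil, List.length_replicate, List.length_cons,
      List.length_nil]
    push_cast
    ring
  have hD : Nat.digits (k + 7) ((k + 7 - 4) * (k + 7) ^ (k + 7 - 1)
      + 2 * (k + 7) ^ (k + 7 - 2) + 1 * (k + 7) ^ (k + 7 - 3) + 1 * (k + 7) ^ 3)
      = [0, 0, 0, 1] ++ (List.replicate k 0 ++ [1, 2, k + 3]) := by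
    rw [hN]
    apply Nat.digits_ofDigits _ (by omega)
    · intro l hl
      simp only [List.mem_append, List.mem_cons, List.mem_replicate, List.not_mem_nil] at hl
      clear hN hz
      grind
    · intro h
      simp
  refine ⟨?_, ?_⟩
  · rw [hD]; simp
  · intro i hi
    rw [← Nat.getD_digits _ _ (by omega), hD, e1]
    have hc : ([0, 0, 0, 1] ++ (List.replicate k 0 ++ [1, 2, k + 3])).count i
        = if i = 0 then k + 3 else if i = 1 then 2 else if i = 2 then 1 else
          if i = k + 3 then 1 else 0 := by
      simp only [List.count_append, List.count_replicate, List.count_cons, List.count_nil,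
        beq_iff_eq]
      split_ifs <;> omega
    rw [hc]
    simp only [List.getD_eq_getElem?_getD, List.getElem?_append, List.getElem?_replicate,
      List.length_replicate, List.length_cons, List.length_nil]
    by_cases h0 : k + 6 - i < 4
    · rw [if_pos (by omega)]
      obtain h | h | h | h : k + 6 - i = 0 ∨ k + 6 - i = 1 ∨ k + 6 - i = 2 ∨ k + 6 - i = 3 := by
        omega
      all_goals rw [h]; simp; split_ifs <;> omega
    · rw [if_neg (by omega)]
      by_cases h1 : i < 3
      · rw [if_neg (by omega)]
        have : k + 6 - i - (0 + 1 + 1 + 1 + 1) - k = 2 - i := by omega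
        rw [this]
        interval_cases i <;> simp
      · rw [if_pos (by omega), if_pos (by omega)]
        simp
        split_ifs <;> omega
end

section
/- For every base b ≥ 7, a natural number n is self-descriptive in base b if and only if n = (b−4)·b^(b−1) + 2·b^(b−2) + 1·b^(b−3) + 1·b^3; that is, this number is the unique self-descriptive number in base b. -/
theorem sd_count (f : ℕ → ℕ) (b i : ℕ) :
    ((List.range b).map f).count i = ((Finset.range b).filter (fun j => f j = i)).card := by
  induction b with
  | zero => simp
  | succ m ih =>
    rw [List.range_succ, List.map_append, List.count_append, ih, Finset.range_add_one,
      Finset.filter_insert]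
    by_cases h : f m = i
    · simp [h]
    · simp [h]

theorem sd_ofDigits (f : ℕ → ℕ) (b m : ℕ) :
    Nat.ofDigits b ((List.range m).map f) = ∑ i ∈ Finset.range m, f i * b ^ i := by
  induction m with
  | zero => simp
  | succ m ih =>
    rw [List.range_succ, List.map_append, Nat.ofDigits_append, ih, Finset.sum_range_succ]
    simp [mul_comm]

theorem sd_digits (b n m : ℕ) (hb : 2 ≤ b) (h : (Nat.digits b n).length = m) :
    Nat.digits b n = (List.range m).map (fun j => n / b ^ j % b) := by
  apply List.ext_getElem
  · simp [h]
  · intro i h1 h2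
    have := Nat.getD_digits n i hb
    rw [List.getElem_map, List.getElem_range, ← this, List.getD_eq_getElem _ _ h1]

theorem sd_comb (b : ℕ) (hb : 7 ≤ b) (d : ℕ → ℕ) (hlt : ∀ i < b, d i < b)
    (hd : ∀ i < b, d i = ((Finset.range b).filter (fun j => d j = i)).card) :
    d 0 = b - 4 ∧ d 1 = 2 ∧ d 2 = 1 ∧ d (b - 4) = 1 ∧
      ∀ i < b, 3 ≤ i → i ≠ b - 4 → d i = 0 := by
  have hS : ∑ i ∈ Finset.range b, d i = b := by
    have := Finset.card_eq_sum_card_fiberwise (f := d) (s := Finset.range b) (t := Finset.range b)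
      (by intro x hx; simpa using hlt x (by simpa using hx))
    rw [Finset.card_range] at this
    rw [Finset.sum_congr rfl (fun i hi => hd i (Finset.mem_range.1 hi))]
    exact this.symm
  have hT : ∑ i ∈ Finset.range b, i * d i = b := by
    have := Finset.sum_fiberwise_of_maps_to (g := d) (s := Finset.range b) (t := Finset.range b)
      (by intro x hx; simpa using hlt x (by simpa using hx)) d
    rw [hS] at this
    refine Eq.trans ?_ this
    apply Finset.sum_congr rfl
    intro i hi
    rw [Finset.sum_congr rfl (fun j hj => (Finset.mem_filter.1 hj).2), Finset.sum_const,
      ← hd i (Finset.mem_range.1 hi), smul_eq_mul, mul_comm]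
  have hk : d 0 ≠ 0 := by
    intro h
    have := hd 0 (by omega)
    rw [h] at this
    have h2 := Finset.card_eq_zero.1 this.symm
    have : 0 ∈ (Finset.range b).filter (fun j => d j = 0) := by
      simp [h]; omega
    rw [h2] at this
    simp at this
  have h2 : ∀ i < b, 1 ≤ i → d i ≤ 2 := by
    intro i hi h1
    have hZ : ∑ j ∈ Finset.range b, (d j + if d j = 0 then 1 else 0) = b + d 0 := by
      rw [Finset.sum_add_distrib, hS, ← Finset.card_filter, ← hd 0 (by omega)]
    have hsub : ({0, i} : Finset ℕ) ⊆ Finset.range b := by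
      intro x; simp; omega
    rw [← Finset.sum_sdiff hsub, Finset.sum_pair (by omega)] at hZ
    have hc : (Finset.range b \ {0, i}).card = b - 2 := by
      rw [Finset.card_sdiff_of_subset hsub, Finset.card_pair (by omega), Finset.card_range]
    have := Finset.card_nsmul_le_sum (Finset.range b \ {0, i})
      (fun j => d j + if d j = 0 then 1 else 0) 1 (by intro j _; split_ifs <;> omega)
    rw [hc, smul_eq_mul] at this
    omega
  have h3 : ∀ v < b, 3 ≤ v → v ≠ d 0 → d v = 0 := by
    intro v hv h3 hne
    rw [hd v hv, Finset.card_eq_zero, Finset.filter_eq_empty_iff]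
    intro j hj he
    rw [Finset.mem_range] at hj
    rcases Nat.eq_zero_or_pos j with rfl | hp
    · exact hne he.symm
    · have := h2 j hj hp; omega
  have b1 := h2 1 (by omega) (by omega)
  have b2 := h2 2 (by omega) (by omega)
  have hkb := hlt 0 (by omega)
  by_cases hk3 : 3 ≤ d 0
  · obtain ⟨k, hkk⟩ : ∃ k, k = d 0 := ⟨_, rfl⟩
    rw [← hkk] at h3 hk hk3 hkb
    have hdk : d k = 1 := by
      rw [hd k hkb, Finset.card_eq_one]
      refine ⟨0, ?_⟩
      ext j
      simp only [Finset.mem_filter, Finset.mem_range, Finset.mem_singleton]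
      constructor
      · rintro ⟨hj, he⟩
        by_contra hp
        have := h2 j hj (by omega); omega
      · rintro rfl; exact ⟨by omega, hkk.symm⟩
    have hsub : ({0, 1, 2, k} : Finset ℕ) ⊆ Finset.range b := by
      intro x; simp; omega
    have key : ∀ j ∈ Finset.range b, j ∉ ({0, 1, 2, k} : Finset ℕ) → d j = 0 := by
      intro j hj hn
      simp at hj hn
      exact h3 j hj (by omega) (by omega)
    have e : ∀ g : ℕ → ℕ, ∑ j ∈ ({0, 1, 2, k} : Finset ℕ), g j = g 0 + (g 1 + (g 2 + g k)) := by
      intro g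
      rw [Finset.sum_insert, Finset.sum_insert, Finset.sum_insert, Finset.sum_singleton] <;>
        simp <;> omega
    rw [← Finset.sum_subset hsub key, e] at hS
    rw [← Finset.sum_subset hsub (by intro j hj hn; rw [key j hj hn, mul_zero]), e] at hT
    rw [hdk] at hT hS
    have hd2 : d 2 = 1 := by omega
    have hd1 : 2 ≤ d 1 := by
      rw [hd 1 (by omega), ← Finset.card_pair (show (2 : ℕ) ≠ k by omega)]
      apply Finset.card_le_card
      intro x
      simp only [Finset.mem_insert, Finset.mem_singleton, Finset.mem_filter, Finset.mem_range]
      rintro (rfl | rfl)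
      · exact ⟨by omega, hd2⟩
      · exact ⟨by omega, hdk⟩
    have hke : k = b - 4 := by omega
    subst hke
    exact ⟨hkk.symm, by omega, hd2, hdk, h3⟩
  · exfalso
    have hsub : ({0, 1, 2} : Finset ℕ) ⊆ Finset.range b := by
      intro x; simp; omega
    rw [← Finset.sum_subset hsub (by
      intro j hj hn
      simp at hj hn
      exact h3 j hj (by omega) (by omega))] at hS
    simp at hS
    omega

/-- The digits of the solution, least significant first. -/
def sdF (b m : ℕ) : ℕ :=
  if m = b - 1 then b - 4 else if m = b - 2 then 2 else if m = b - 3 then 1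
    else if m = 3 then 1 else 0

theorem sdF_sum (b : ℕ) (hb : 7 ≤ b) : Nat.ofDigits b ((List.range b).map (sdF b)) =
    (b - 4) * b ^ (b - 1) + 2 * b ^ (b - 2) + 1 * b ^ (b - 3) + 1 * b ^ 3 := by
  rw [sd_ofDigits]
  have hsub : ({b - 1, b - 2, b - 3, 3} : Finset ℕ) ⊆ Finset.range b := by
    intro x; simp; omega
  rw [← Finset.sum_subset hsub (by
    intro j _ hn
    simp at hn
    simp [sdF, hn])]
  have v1 : sdF b (b - 1) = b - 4 := by simp [sdF]
  have v2 : sdF b (b - 2) = 2 := by unfold sdF; split_ifs <;> omega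
  have v3 : sdF b (b - 3) = 1 := by unfold sdF; split_ifs <;> omega
  have v4 : sdF b 3 = 1 := by unfold sdF; split_ifs <;> omega
  rw [Finset.sum_insert (by simp; omega), Finset.sum_insert (by simp; omega),
    Finset.sum_insert (by simp; omega), Finset.sum_singleton, v1, v2, v3, v4]
  ring

theorem sdF_digits (b : ℕ) (hb : 7 ≤ b) :
    Nat.digits b (Nat.ofDigits b ((List.range b).map (sdF b))) = (List.range b).map (sdF b) := by
  apply Nat.digits_ofDigits b (by omega)
  · intro l hl
    obtain ⟨i, _, rfl⟩ := List.mem_map.1 hl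
    unfold sdF; split_ifs <;> omega
  · intro h
    rw [List.getLast_map, List.getLast_range]
    simp [sdF]; omega

theorem sdF_count (b : ℕ) (hb : 7 ≤ b) (i : ℕ) (hi : i < b) :
    ((Finset.range b).filter (fun j => sdF b j = i)).card = sdF b (b - 1 - i) := by
  have go : ∀ s : Finset ℕ, (∀ j, j ∈ s ↔ j < b ∧ sdF b j = i) → s.card = sdF b (b - 1 - i) →
      ((Finset.range b).filter (fun j => sdF b j = i)).card = sdF b (b - 1 - i) := by
    intro s hs hc
    rw [← hc]
    congr 1
    ext j
    simp [hs]
  by_cases h0 : i = 0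
  · subst h0
    have hsub : ({b - 1, b - 2, b - 3, 3} : Finset ℕ) ⊆ Finset.range b := by
      intro x; simp; omega
    apply go (Finset.range b \ {b - 1, b - 2, b - 3, 3})
    · intro j
      simp only [Finset.mem_sdiff, Finset.mem_range, Finset.mem_insert, Finset.mem_singleton]
      unfold sdF; split_ifs <;> first | omega | grind
    · rw [Finset.card_sdiff_of_subset hsub, Finset.card_range,
        Finset.card_insert_of_notMem (by simp; omega),
        Finset.card_insert_of_notMem (by simp; omega), Finset.card_pair (by omega)]
      simp [sdF]
  by_cases h1 : i = 1
  · subst h1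
    apply go {b - 3, 3}
    · intro j
      simp only [Finset.mem_insert, Finset.mem_singleton]
      unfold sdF; split_ifs <;> first | omega | grind
    · rw [Finset.card_pair (by omega)]
      unfold sdF; split_ifs <;> first | omega | grind
  by_cases h2 : i = 2
  · subst h2
    apply go {b - 2}
    · intro j
      simp only [Finset.mem_singleton]
      unfold sdF; split_ifs <;> first | omega | grind
    · rw [Finset.card_singleton]
      unfold sdF; split_ifs <;> first | omega | grind
  by_cases h4 : i = b - 4
  · apply go {b - 1}
    · intro j
      simp only [Finset.mem_singleton]
      unfold sdF; split_ifs <;> first | omega | grind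
    · rw [Finset.card_singleton]
      unfold sdF; split_ifs <;> first | omega | grind
  · apply go ∅
    · intro j
      simp only [Finset.notMem_empty, false_iff]
      unfold sdF; split_ifs <;> first | omega | grind
    · rw [Finset.card_empty]
      unfold sdF; split_ifs <;> first | omega | grind

theorem selfDescriptive_general_iff (b : ℕ) (hb : 7 ≤ b) (n : ℕ) :
    IsSelfDescriptive b n ↔
      n = (b - 4) * b ^ (b - 1) + 2 * b ^ (b - 2) + 1 * b ^ (b - 3) + 1 * b ^ 3 := by
  rw [← sdF_sum b hb]
  constructor
  · rintro ⟨hl, hc⟩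
    have hL := sd_digits b n b (by omega) hl
    have hcomb := sd_comb b hb (fun i => n / b ^ (b - 1 - i) % b)
      (fun i _ => Nat.mod_lt _ (by omega)) (by
        intro i hi
        rw [hc i hi, hL, sd_count]
        apply Finset.card_bij' (fun j _ => b - 1 - j) (fun j _ => b - 1 - j)
        · intro j hj
          simp only [Finset.mem_filter, Finset.mem_range] at hj ⊢
          rw [show b - 1 - (b - 1 - j) = j by omega]
          exact ⟨by omega, hj.2⟩
        · intro j hj
          simp only [Finset.mem_filter, Finset.mem_range] at hj ⊢
          exact ⟨by omega, hj.2⟩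
        · intro j hj
          simp only [Finset.mem_filter, Finset.mem_range] at hj
          omega
        · intro j hj
          simp only [Finset.mem_filter, Finset.mem_range] at hj
          omega)
    obtain ⟨c0, c1, c2, c4, c⟩ := hcomb
    rw [← Nat.ofDigits_digits b n, hL]
    congr 1
    apply List.map_congr_left
    intro m hm
    rw [List.mem_range] at hm
    unfold sdF
    split_ifs with h1 h2 h3 h4
    · rw [h1]; exact c0
    · rw [h2]; exact c1
    · rw [h3, show b - 3 = b - 1 - 2 by omega]; exact c2
    · rw [h4, show 3 = b - 1 - (b - 4) by omega]; exact c4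
    · have := c (b - 1 - m) (by omega) (by omega) (by omega)
      rwa [show b - 1 - (b - 1 - m) = m by omega] at this
  · intro hn
    have hD : Nat.digits b n = (List.range b).map (sdF b) := by rw [hn, sdF_digits b hb]
    refine ⟨by rw [hD]; simp, ?_⟩
    intro i hi
    rw [hD, sd_count, sdF_count b hb i hi, ← Nat.getD_digits n _ (by omega), hD,
      List.getD_eq_getElem _ _ (by simp; omega)]
    simp
end

section
/- If b ≥ 2 and n is self-descriptive in base b, then the leading digit j_0 of n (the digit at position 0, i.e., the coefficient of b^(b−1), which counts the occurrences of the digit 0 in n) satisfies 1 ≤ j_0 ≤ b − 2. -/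
theorem leading_digit_bounds (b n : ℕ) (hb : 2 ≤ b) (h : IsSelfDescriptive b n) :
    1 ≤ n / b ^ (b - 1) % b ∧ n / b ^ (b - 1) % b ≤ b - 2 := by
  obtain ⟨hlen, hcount⟩ := h
  have hn : n ≠ 0 := by
    rintro rfl
    simp at hlen
    omega
  have hne : Nat.digits b n ≠ [] := Nat.digits_ne_nil_iff_ne_zero.2 hn
  have hlast := Nat.getLast_digit_ne_zero b hn
  have htop : n / b ^ (b - 1) % b = (Nat.digits b n).getLast hne := by
    rw [← Nat.getD_digits n (b - 1) hb, List.getLast_eq_getElem]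
    simp [hlen, List.getD_eq_getElem?_getD, show b - 1 < b by omega]
  have hpos : n / b ^ (b - 1) % b ≠ 0 := by rw [htop]; exact hlast
  refine ⟨Nat.one_le_iff_ne_zero.2 hpos, ?_⟩
  have hlt : n / b ^ (b - 1) % b < b := Nat.mod_lt _ (by omega)
  by_contra hcon
  have heq : n / b ^ (b - 1) % b = b - 1 := by omega
  have h0 := hcount 0 (by omega)
  simp only [Nat.sub_zero] at h0
  have h1 := hcount (b - 1) (by omega)
  simp only [Nat.sub_self, pow_zero, Nat.div_one] at h1
  have hmem : b - 1 ∈ Nat.digits b n := by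
    rw [← heq, htop]; exact List.getLast_mem hne
  have hc : 0 < (Nat.digits b n).count (b - 1) := List.count_pos_iff.2 hmem
  have hd := Nat.digits_eq_cons_digits_div (b := b) (by omega) hn
  have hM : Nat.digits b (n / b) ≠ [] := by
    intro hM
    rw [hd, hM] at hlen
    simp at hlen
    omega
  have hM0 : n / b ≠ 0 := Nat.digits_ne_nil_iff_ne_zero.1 hM
  have hlast2 := Nat.getLast_digit_ne_zero b hM0
  have hcM : (Nat.digits b n).count 0 = (Nat.digits b (n / b)).count 0 := by
    rw [hd, List.count_cons_of_ne (by omega)]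
  have hlM : (Nat.digits b n).length = (Nat.digits b (n / b)).length + 1 := by
    rw [hd]; simp
  have hall : (Nat.digits b (n / b)).count 0 = (Nat.digits b (n / b)).length := by omega
  exact hlast2 (List.count_eq_length.1 hall _ (List.getLast_mem hM)).symm
end

section
/- If b ≥ 2 and n is self-descriptive in base b, then among the digits of n at positions 1, 2, …, b−1 (all digits except the leading digit at position 0), exactly one digit equals 2 and every other one equals 0 or 1. -/
lemma cnt (f : ℕ → ℕ) (i c : ℕ) : ((List.range c).map f).count i
    = ∑ j ∈ Finset.range c, if f j = i then 1 else 0 := by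
  induction c with
  | zero => simp
  | succ c ih =>
    rw [List.range_succ, Finset.sum_range_succ, ← ih, List.map_append, List.count_append]
    simp [List.count_singleton]

lemma core (b : ℕ) (hb : 2 ≤ b) (d : ℕ → ℕ) (hd : ∀ j, d j < b)
    (hc : ∀ i < b, d i = ∑ j ∈ Finset.range b, if d j = i then 1 else 0) :
    (∃! i : ℕ, 1 ≤ i ∧ i ≤ b - 1 ∧ d i = 2) ∧
    ∀ i : ℕ, 1 ≤ i → i ≤ b - 1 → d i ≠ 2 → d i = 0 ∨ d i = 1 := by
  have hsum : ∑ i ∈ Finset.range b, d i = b := by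
    rw [Finset.sum_congr rfl (fun i hi => hc i (Finset.mem_range.1 hi)), Finset.sum_comm]
    simp [hd]
  have h0 : d 0 ≠ 0 := by
    intro h
    have h1 := hc 0 (by omega)
    rw [h] at h1
    have := (Finset.sum_eq_zero_iff.1 h1.symm) 0 (by simp; omega)
    simp [h] at this
  have hz := hc 0 (by omega)
  obtain ⟨m, rfl⟩ : ∃ m, b = m + 1 := ⟨b - 1, by omega⟩
  rw [Finset.sum_range_succ'] at hsum hz
  simp only [h0, if_false, add_zero] at hz
  have he : ∑ i ∈ Finset.range m, (d (i+1) - 1) = 1 := by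
    have : ∑ i ∈ Finset.range m, (d (i+1) + if d (i+1) = 0 then 1 else 0)
        = ∑ i ∈ Finset.range m, ((d (i+1) - 1) + 1) := by
      apply Finset.sum_congr rfl
      intro i _
      split_ifs <;> omega
    rw [Finset.sum_add_distrib, Finset.sum_add_distrib, ← hz] at this
    simp at this
    omega
  obtain ⟨k, hk, hk0⟩ : ∃ k ∈ Finset.range m, d (k+1) - 1 ≠ 0 := by
    by_contra! hcon
    rw [Finset.sum_eq_zero hcon] at he
    omega
  rw [← Finset.add_sum_erase _ _ hk] at he
  have hr : ∑ i ∈ (Finset.range m).erase k, (d (i+1) - 1) = 0 := by omega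
  have hr' := Finset.sum_eq_zero_iff.1 hr
  have key : ∀ i, 1 ≤ i → i ≤ m → i ≠ k + 1 → d i ≤ 1 := by
    intro i h1 h2 h3
    obtain ⟨i, rfl⟩ : ∃ m, i = m + 1 := ⟨i - 1, by omega⟩
    have := hr' i (by simp; omega)
    omega
  have hk2 : d (k+1) = 2 := by omega
  have hkm := Finset.mem_range.1 hk
  refine ⟨⟨k+1, ⟨by omega, by omega, hk2⟩, ?_⟩, ?_⟩
  · rintro i ⟨h1, h2, h3⟩
    by_contra hne
    have := key i h1 (by omega) hne
    omega
  · intro i h1 h2 h3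
    have := key i h1 (by omega) (by rintro rfl; exact h3 hk2)
    omega

theorem nonleading_digits_structure (b n : ℕ) (hb : 2 ≤ b) (h : IsSelfDescriptive b n) :
    (∃! i : ℕ, 1 ≤ i ∧ i ≤ b - 1 ∧ n / b ^ (b - 1 - i) % b = 2) ∧
    ∀ i : ℕ, 1 ≤ i → i ≤ b - 1 → n / b ^ (b - 1 - i) % b ≠ 2 →
      n / b ^ (b - 1 - i) % b = 0 ∨ n / b ^ (b - 1 - i) % b = 1 := by
  obtain ⟨hl, hc⟩ := h
  refine core b hb (fun i => n / b ^ (b - 1 - i) % b) (fun j => Nat.mod_lt _ (by omega)) ?_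
  intro i hi
  have hL : Nat.digits b n = (List.range b).map (fun j => n / b ^ j % b) := by
    apply List.ext_getElem
    · simp [hl]
    · intro j h1 h2
      have := Nat.getD_digits n j hb
      rw [List.getD_eq_getElem _ _ h1] at this
      simpa using this
  have h2 : (Nat.digits b n).count i
      = ∑ j ∈ Finset.range b, if n / b ^ j % b = i then 1 else 0 := by
    rw [hL, cnt]
  have h3 := hc i hi
  rw [h2] at h3
  exact h3.trans (Finset.sum_range_reflect (fun j => if n / b ^ j % b = i then 1 else 0) b).symm
end

section
/- If b ≥ 2 and n is self-descriptive in base b, then the digit j_1 of n at position 1 (the coefficient of b^(b−2), which counts the occurrences of the digit 1 in n) satisfies j_1 ≤ 2. -/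
theorem count_map_range_aux (g : ℕ → ℕ) (i b : ℕ) :
    ((List.range b).map g).count i = ∑ k ∈ Finset.range b, if g k = i then 1 else 0 := by
  induction b with
  | zero => simp
  | succ b ih =>
    rw [List.range_succ, List.map_append, List.count_append, ih, Finset.sum_range_succ]
    simp [List.count_singleton]

theorem digit_one_le_two (b n : ℕ) (hb : 2 ≤ b) (h : IsSelfDescriptive b n) :
    n / b ^ (b - 2) % b ≤ 2 := by
  obtain ⟨hlen, hc⟩ := h
  have hL : Nat.digits b n = (List.range b).map (fun k => n / b ^ k % b) := by
    apply List.ext_getElem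
    · simp [hlen]
    · intro k h1 h2
      have := Nat.getD_digits n k hb
      rw [List.getD_eq_getElem _ _ h1] at this
      simp [this]
  set f : ℕ → ℕ := fun i => n / b ^ (b - 1 - i) % b with hf
  have hcount : ∀ i < b, f i = ∑ k ∈ Finset.range b, if f k = i then 1 else 0 := by
    intro i hi
    have h1 := hc i hi
    rw [hL, count_map_range_aux, ← Finset.sum_range_reflect] at h1
    exact h1
  have hlt : ∀ k, f k < b := fun k => Nat.mod_lt _ (by omega)
  have hsum : ∑ i ∈ Finset.range b, f i = b := by
    rw [Finset.sum_congr rfl (fun i hi => hcount i (Finset.mem_range.1 hi)), Finset.sum_comm]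
    simp [hlt]
  have h0 : f 0 ≠ 0 := by
    intro h0
    have h1 := hcount 0 (by omega)
    rw [h0] at h1
    have := (Finset.sum_eq_zero_iff.1 h1.symm) 0 (Finset.mem_range.2 (by omega))
    simp [h0] at this
  have hz := hcount 0 (by omega)
  change f 1 ≤ 2
  obtain ⟨m, rfl⟩ : ∃ m, b = m + 2 := ⟨b - 2, by omega⟩
  clear_value f
  have hle : ∀ k, 1 ≤ f k + if f k = 0 then 1 else 0 := by
    intro k; split_ifs <;> omega
  have hS : ∑ k ∈ Finset.range m, 1 ≤
      ∑ k ∈ Finset.range m, (f (k+1+1) + if f (k+1+1) = 0 then 1 else 0) :=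
    Finset.sum_le_sum fun k _ => hle _
  rw [Finset.sum_add_distrib] at hS
  rw [Finset.sum_range_succ', Finset.sum_range_succ'] at hsum hz
  simp only [Finset.sum_const, Finset.card_range, smul_eq_mul, mul_one, zero_add] at hS hsum hz
  by_contra hcon
  rw [if_neg h0, if_neg (by omega)] at hz
  omega
end

section
/- If b ≥ 2, n is self-descriptive in base b, and the digit of n at position 1 (the coefficient of b^(b−2), which counts the occurrences of the digit 1 in n) equals 0, then b = 4 and n = 136 (base-4 representation 2020). -/
theorem count_aux (f : ℕ → ℕ) (i b : ℕ) :
    ((List.range b).map f).count i = ∑ j ∈ Finset.range b, if f j = i then 1 else 0 := by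
  induction b with
  | zero => simp
  | succ k ih =>
    rw [List.range_succ, Finset.sum_range_succ, List.map_append, List.count_append, ih]
    simp [List.count_singleton]

theorem comb_aux (b : ℕ) (f : ℕ → ℕ) (hb : 2 ≤ b) (hlt : ∀ i, f i < b)
    (hf : ∀ i < b, f i = ∑ j ∈ Finset.range b, if f j = i then 1 else 0) (h1 : f 1 = 0) :
    b = 4 ∧ f 0 = 2 ∧ f 2 = 2 ∧ f 3 = 0 := by
  have hsum : ∑ i ∈ Finset.range b, f i = b := by
    rw [Finset.sum_congr rfl (fun i hi => hf i (Finset.mem_range.1 hi)), Finset.sum_comm]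
    simp [hlt]
  have hpos : ∀ j < b, 0 < f (f j) := by
    intro j hj
    rw [hf _ (hlt j), ← Finset.card_filter, Finset.card_pos]
    exact ⟨j, by simp [hj]⟩
  have hne1 : ∀ j < b, f j ≠ 1 := by
    intro j hj h
    have := hpos j hj
    rw [h] at this; omega
  have h0 : f 0 ≠ 0 := by
    intro h
    have := hpos 0 (by omega)
    rw [h] at this; omega
  set S := ((Finset.range b).filter (fun j => ¬ f j = 0)).erase 0 with hS
  have h0m : 0 ∈ (Finset.range b).filter (fun j => ¬ f j = 0) := by simp [h0]; omega
  have hc0 : f 0 = ((Finset.range b).filter (fun j => f j = 0)).card := by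
    rw [Finset.card_filter]; exact hf 0 (by omega)
  have hc1 := Finset.card_filter_add_card_filter_not (s := Finset.range b) (fun j => f j = 0)
  rw [Finset.card_range, ← hc0, ← Finset.card_erase_add_one h0m, ← hS] at hc1
  have hs1 := Finset.sum_filter_ne_zero (s := Finset.range b) (f := f)
  have hs2 := Finset.add_sum_erase _ f h0m
  rw [← hS] at hs2
  have hs3 : f 0 + ∑ j ∈ S, f j = b := by
    rw [hs2]; exact hs1.trans hsum
  have hmem : ∀ j, j ∈ S ↔ j ≠ 0 ∧ j < b ∧ f j ≠ 0 := by intro j; simp [hS]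
  have hge : S.card * 2 ≤ ∑ j ∈ S, f j := by
    rw [← smul_eq_mul]
    apply Finset.card_nsmul_le_sum
    intro j hj
    have := (hmem j).1 hj
    have := hne1 j this.2.1
    omega
  have hzS : f 0 ∈ S := (hmem _).2 ⟨h0, hlt 0, (hpos 0 (by omega)).ne'⟩
  have hcp : 0 < S.card := Finset.card_pos.2 ⟨_, hzS⟩
  have hcard : S.card = 1 := by omega
  obtain ⟨a, ha⟩ := Finset.card_eq_one.1 hcard
  rw [ha] at hzS hs3
  simp at hzS hs3
  have hfa : f a = 2 := by omega
  have h2 : 2 ∈ S := (hmem 2).2 ⟨by omega, by have := hlt a; omega, by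
    have := hpos a (by have := hlt 0; omega)
    rw [hfa] at this; omega⟩
  rw [ha] at h2
  simp at h2
  subst h2
  refine ⟨by omega, hzS, hfa, ?_⟩
  by_contra h3
  have : 3 ∈ S := (hmem 3).2 ⟨by omega, by omega, h3⟩
  rw [ha] at this
  simp at this

theorem digit_one_eq_zero_case (b n : ℕ) (hb : 2 ≤ b) (h : IsSelfDescriptive b n)
    (h1 : n / b ^ (b - 2) % b = 0) : b = 4 ∧ n = 136 := by
  obtain ⟨hl, hd⟩ := h
  have hrev : (Nat.digits b n).reverse =
      (List.range b).map (fun i => n / b ^ (b - 1 - i) % b) := by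
    apply List.ext_getElem
    · simp [hl]
    · intro i h₁ h₂
      simp only [List.getElem_reverse, List.getElem_map, List.getElem_range, hl]
      rw [← Nat.getD_digits n _ hb, List.getD_eq_getElem]
  have key := comb_aux b (fun i => n / b ^ (b - 1 - i) % b) hb
    (fun i => Nat.mod_lt _ (by omega))
    (fun i hi => by
      rw [← count_aux, ← hrev, List.count_reverse]
      exact hd i hi)
    (by simpa [Nat.sub_sub] using h1)
  obtain ⟨rfl, k0, k2, k3⟩ := key
  have hn : n < 4 ^ 4 := by
    have := Nat.lt_base_pow_length_digits (b := 4) (m := n) (by omega)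
    rwa [hl] at this
  norm_num at k0 k2 k3 h1 hn
  refine ⟨rfl, ?_⟩
  omega
end

section
/- If b ≥ 2, n is self-descriptive in base b, and the digit of n at position 1 (the coefficient of b^(b−2), which counts the occurrences of the digit 1 in n) equals 1, then b = 5 and n = 1425 (base-5 representation 21200). -/
open Finset in
theorem aux_core (b : ℕ) (a : ℕ → ℕ) (hb : 2 ≤ b) (hlt : ∀ i < b, a i < b)
    (hc : ∀ i < b, a i = #{j ∈ range b | a j = i}) (h1 : a 1 = 1) :
    b = 5 ∧ a 0 = 2 ∧ a 2 = 2 ∧ a 3 = 0 ∧ a 4 = 0 := by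
  have hpos : ∀ j < b, 1 ≤ a (a j) := by
    intro j hj
    rw [hc (a j) (hlt j hj)]
    exact Finset.card_pos.mpr ⟨j, by simp [hj]⟩
  have huniq : ∀ x < b, a x = 1 → x = 1 := by
    intro x hx hx1
    have h := hc 1 (by omega)
    rw [h1] at h
    have h' := Finset.card_le_one.mp h.symm.le
    exact h' x (by simp [hx, hx1]) 1 (by simp [h1]; omega)
  have hsum : ∑ i ∈ range b, a i = b := by
    have h := Finset.card_eq_sum_card_fiberwise (f := a) (s := range b) (t := range b)
      (by intro x hx; simp at hx ⊢; exact hlt x hx)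
    rw [Finset.card_range] at h
    conv_rhs => rw [h]
    exact Finset.sum_congr rfl (fun i hi => hc i (by simpa using hi))
  have hz : ∑ i ∈ range b, (if a i = 0 then 1 else 0) = a 0 := by
    rw [hc 0 (by omega), Finset.card_filter]
  have hf : ∑ i ∈ range b, (a i - 1) = a 0 := by
    have e : ∑ i ∈ range b, (a i + (if a i = 0 then 1 else 0)) = ∑ i ∈ range b, ((a i - 1) + 1) :=
      Finset.sum_congr rfl (fun i _ => by split_ifs <;> omega)
    rw [Finset.sum_add_distrib, Finset.sum_add_distrib, hsum, hz] at e
    simp at e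
    omega
  have h0 : 2 ≤ a 0 := by
    have p := hpos 0 (by omega)
    by_contra hh
    have : a 0 = 0 ∨ a 0 = 1 := by omega
    rcases this with h | h
    · rw [h] at p; omega
    · have := huniq 0 (by omega) h
      omega
  have hkb := hlt 0 (by omega)
  have hk : 2 ≤ a (a 0) := by
    have p := hpos 0 (by omega)
    by_contra hh
    have := huniq (a 0) hkb (by omega)
    omega
  have hk2 : a (a 0) = 2 := by
    have h := Finset.sum_le_sum_of_subset (f := fun i => a i - 1) (s := {0, a 0}) (t := range b)
      (by intro x; simp; omega)
    rw [hf, Finset.sum_pair (by omega)] at h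
    omega
  have hx : ∀ x < b, x ≠ 0 → x ≠ 1 → x ≠ a 0 → a x = 0 := by
    intro x hxb hx0 hx1 hxk
    have h := Finset.sum_le_sum_of_subset (f := fun i => a i - 1) (s := {0, a 0, x}) (t := range b)
      (by intro x; simp; omega)
    rw [hf, Finset.sum_insert (by simp; omega), Finset.sum_pair (by omega)] at h
    have := huniq x hxb
    omega
  have p2 := hpos (a 0) hkb
  rw [hk2] at p2
  have hk' : a 0 = 2 := by
    by_contra hh
    have := hx 2 (by omega) (by omega) (by omega) (by omega)
    omega
  rw [hk'] at hx hk2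
  have hb5 : b = 5 := by
    have hs := Finset.sum_subset (f := a) (s₁ := range 3) (s₂ := range b)
      (by intro x; simp; omega)
      (by intro x hxb hx3; simp at hxb hx3; exact hx x hxb (by omega) (by omega) (by omega))
    rw [hsum] at hs
    simp [Finset.sum_range_succ] at hs
    omega
  refine ⟨hb5, hk', hk2, hx 3 ?_ ?_ ?_ ?_, hx 4 ?_ ?_ ?_ ?_⟩ <;> omega

open Finset in
theorem aux_count (b n : ℕ) (hb : 2 ≤ b) (hl : (Nat.digits b n).length = b) (i : ℕ) :
    (Nat.digits b n).count i = #{j ∈ range b | n / b ^ (b - 1 - j) % b = i} := by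
  have hL : Nat.digits b n = (List.range b).map (fun k => n / b ^ k % b) := by
    apply List.ext_getElem
    · simp [hl]
    · intro k h₁ h₂
      have := Nat.getD_digits n k hb
      rw [List.getD_eq_getElem _ _ h₁] at this
      simp [this]
  have h2 : (Nat.digits b n).count i = #{j ∈ range b | n / b ^ j % b = i} := by
    rw [hL, List.count_eq_countP, List.countP_map, List.countP_eq_length_filter]
    rw [Finset.card_def, Finset.filter_val, Finset.range_val, Multiset.range, Multiset.filter_coe,
      Multiset.coe_card]
    congr 1
  rw [h2, Finset.card_filter, Finset.card_filter]
  exact (Finset.sum_range_reflect (fun j => if n / b ^ j % b = i then 1 else 0) b).symm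


theorem digit_one_eq_one_case (b n : ℕ) (hb : 2 ≤ b) (h : IsSelfDescriptive b n)
    (h1 : n / b ^ (b - 2) % b = 1) : b = 5 ∧ n = 1425 := by
  obtain ⟨hl, hd⟩ := h
  have hcore := aux_core b (fun i => n / b ^ (b - 1 - i) % b) hb
    (fun i _ => Nat.mod_lt _ (by omega))
    (fun i hi => (hd i hi).trans (aux_count b n hb hl i))
    (by simpa [Nat.sub_sub] using h1)
  obtain ⟨rfl, c0, c2, c3, c4⟩ := hcore
  have hn : n < 5 ^ 5 := by
    have := Nat.lt_base_pow_length_digits (b := 5) (m := n) (by norm_num)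
    rwa [hl] at this
  norm_num at c0 c2 c3 c4 h1 hn
  refine ⟨rfl, ?_⟩
  omega
end

section
/- If b ≥ 2, n is self-descriptive in base b, and the digit of n at position 1 (the coefficient of b^(b−2), which counts the occurrences of the digit 1 in n) equals 2, then either b = 4 and n = 100 (base-4 representation 1210), or b ≥ 7 and n = (b−4)·b^(b−1) + 2·b^(b−2) + 1·b^(b−3) + 1·b^3. -/
lemma aux_sum (b n : ℕ) : ∀ k, n % b ^ k = ∑ j ∈ Finset.range k, (n / b ^ j % b) * b ^ j := by
  intro k
  induction k with
  | zero => simp [Nat.mod_one]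
  | succ k ih =>
    rw [Finset.sum_range_succ, ← ih, Nat.mod_pow_succ]
    ring

lemma aux_digits (b n : ℕ) (hb : 2 ≤ b) (hl : (Nat.digits b n).length = b) :
    Nat.digits b n = (List.range b).map (fun j => n / b ^ j % b) := by
  apply List.ext_getElem
  · simp [hl]
  · intro i h1 h2
    rw [← List.getD_eq_getElem _ 0 h1, Nat.getD_digits n i hb]
    simp

lemma aux_count_s16 (b i : ℕ) (f : ℕ → ℕ) : ((List.range b).map f).count i
    = ∑ j ∈ Finset.range b, if f j = i then 1 else 0 := by
  induction b with
  | zero => simp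
  | succ k ih =>
    rw [List.range_succ, Finset.sum_range_succ, ← ih]
    simp [List.count_singleton]

lemma aux_core_s16 (b : ℕ) (d : ℕ → ℕ) (hb : 2 ≤ b) (hlt : ∀ i, d i < b) (h0 : d 0 ≠ 0)
    (h1 : d 1 = 2)
    (hc : ∀ i < b, d i = ∑ j ∈ Finset.range b, if d j = i then 1 else 0) :
    (b = 4 ∧ ∀ i < b, d i = if i = 0 then 1 else if i = 1 then 2 else if i = 2 then 1 else 0) ∨
    (7 ≤ b ∧ ∀ i < b, d i = (if i = 0 then b - 4 else 0) + (if i = 1 then 2 else 0)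
      + (if i = 2 then 1 else 0) + (if i = b - 4 then 1 else 0)) := by
  have hb3 : 2 < b := h1 ▸ hlt 1
  have hsum : ∑ i ∈ Finset.range b, d i = b := by
    rw [Finset.sum_congr rfl (fun i hi => hc i (Finset.mem_range.1 hi)), Finset.sum_comm]
    rw [Finset.sum_congr rfl (g := fun _ => 1)]
    · simp
    · intro j _
      simp [hlt j]
  have hz := hc 0 (by omega)
  obtain ⟨m, rfl⟩ : ∃ m, b = m + 2 := ⟨b - 2, by omega⟩
  have key : ∀ i < m, d (i + 2) ≤ 1 := by
    have e : ∑ i ∈ Finset.range m, 1 =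
        ∑ i ∈ Finset.range m, (d (i + 2) + if d (i + 2) = 0 then 1 else 0) := by
      rw [Finset.sum_add_distrib]
      rw [Finset.sum_range_succ', Finset.sum_range_succ'] at hsum hz
      simp [h1, h0, add_assoc] at hsum hz ⊢
      omega
    rw [Finset.sum_eq_sum_iff_of_le] at e
    · intro i hi
      have := e i (Finset.mem_range.2 hi)
      omega
    · intro i _
      split_ifs <;> omega
  have key2 : ∀ i, 2 ≤ i → i < m + 2 → d i ≤ 1 := by
    intro i h2 h3
    obtain ⟨k, rfl⟩ : ∃ k, i = k + 2 := ⟨i - 2, by omega⟩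
    exact key k (by omega)
  have hcard : ∀ i < m + 2, d i = ((Finset.range (m + 2)).filter (fun j => d j = i)).card := by
    intro i hi
    rw [Finset.card_filter]
    exact hc i hi
  have hpos : ∀ j < m + 2, 1 ≤ d (d j) := by
    intro j hj
    rw [hcard _ (hlt j)]
    exact Finset.card_pos.2 ⟨j, by simp [hj]⟩
  have h2 : d 2 = 1 := by
    have := hpos 1 (by omega)
    rw [h1] at this
    have := key2 2 le_rfl hb3
    omega
  have hsub : ∀ i < m + 2, ∀ s : Finset ℕ, (∀ j ∈ s, j < m + 2 ∧ d j = i) → d i ≤ s.card →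
      ∀ j < m + 2, d j = i → j ∈ s := by
    intro i hi s hs hle j hj hji
    have : s = (Finset.range (m + 2)).filter (fun j => d j = i) := by
      apply Finset.eq_of_subset_of_card_le
      · intro j hj
        simpa using hs j hj
      · rw [← hcard i hi]; exact hle
    rw [this]
    simp [hj, hji]
  have h02 : d 0 ≠ 2 := by
    intro h
    have := hsub 2 hb3 {1} (by simp [h1]) (by simp [h2]) 0 (by omega) h
    simp at this
  by_cases h01 : d 0 = 1
  · left
    have hh := hsub 1 (by omega) {0, 2} (by simp [h01, h2]; omega) (by simp [h1])
    have hd : ∀ i < m + 2, d i = (if i = 0 then 1 else 0) + (if i = 1 then 2 else 0)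
      + (if i = 2 then 1 else 0) := by
      intro i hi
      have := hh i hi
      simp at this
      have := key2 i
      rcases i with _ | _ | _ | i <;> simp <;> grind
    have hs4 : m + 2 = 4 := by
      rw [Finset.sum_congr rfl (fun i hi => hd i (Finset.mem_range.1 hi))] at hsum
      have : 0 < m := by omega
      simp [Finset.sum_add_distrib, this] at hsum
      omega
    refine ⟨hs4, ?_⟩
    intro i hi
    rw [hd i hi]
    split_ifs <;> omega
  · right
    have hk : 3 ≤ d 0 := by omega
    have hdk : d (d 0) = 1 := by
      have := hpos 0 (by omega)
      have := key2 (d 0) (by omega) (hlt 0)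
      omega
    have hl0 := hlt 0
    have hh := hsub 1 (by omega) {2, d 0} (by simp [h2, hdk]; omega)
      (by rw [Finset.card_pair (by omega)]; omega)
    have hd : ∀ i < m + 2, d i = (if i = 0 then d 0 else 0) + (if i = 1 then 2 else 0)
      + (if i = 2 then 1 else 0) + (if i = d 0 then 1 else 0) := by
      intro i hi
      have h5 := hh i hi
      simp at h5
      have h6 := key2 i
      by_cases i0 : i = 0
      · subst i0; simp; omega
      by_cases i1 : i = 1
      · subst i1; rw [if_neg (show (1:ℕ) ≠ d 0 by omega)]; simp; omega
      by_cases i2 : i = 2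
      · subst i2; rw [if_neg (show (2:ℕ) ≠ d 0 by omega)]; simp; omega
      by_cases i3 : i = d 0
      · rw [if_neg i0, if_neg i1, if_neg i2, if_pos i3, i3]; omega
      · rw [if_neg i0, if_neg i1, if_neg i2, if_neg i3]; omega
    have hs4 : d 0 + 4 = m + 2 := by
      rw [Finset.sum_congr rfl (fun i hi => hd i (Finset.mem_range.1 hi))] at hsum
      have : 0 < m := by omega
      simp [Finset.sum_add_distrib, this, hl0] at hsum
      omega
    have e0 : d 0 = m + 2 - 4 := by omega
    rw [e0] at hd
    exact ⟨by omega, hd⟩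

theorem digit_one_eq_two_case (b n : ℕ) (hb : 2 ≤ b) (h : IsSelfDescriptive b n)
    (h1 : n / b ^ (b - 2) % b = 2) :
    (b = 4 ∧ n = 100) ∨
    (7 ≤ b ∧ n = (b - 4) * b ^ (b - 1) + 2 * b ^ (b - 2) + 1 * b ^ (b - 3) + 1 * b ^ 3) := by
  obtain ⟨hl, hc⟩ := h
  have hn : n < b ^ b := by
    have := Nat.lt_base_pow_length_digits (b := b) (m := n) (by omega)
    rwa [hl] at this
  have hge : b ^ (b - 1) ≤ n := by
    by_contra hlt
    have := (Nat.digits_length_le_iff (b := b) (k := b - 1) (by omega) n).2 (by omega)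
    omega
  have hS := aux_sum b n b
  rw [Nat.mod_eq_of_lt hn, ← Finset.sum_range_reflect] at hS
  have hD := aux_digits b n hb hl
  have := aux_core_s16 b (fun i => n / b ^ (b - 1 - i) % b) hb (fun i => Nat.mod_lt _ (by omega))
    (by
      have hq : n / b ^ (b - 1) < b := by
        apply Nat.div_lt_of_lt_mul
        rwa [← pow_succ, Nat.sub_add_cancel (by omega)]
      have : 0 < n / b ^ (b - 1) := Nat.div_pos hge (by positivity)
      simp only [Nat.sub_zero]
      rw [Nat.mod_eq_of_lt hq]
      omega)
    (by simpa [Nat.sub_sub] using h1)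
    (by
      intro i hi
      rw [hc i hi, hD, aux_count_s16, ← Finset.sum_range_reflect])
  rcases this with ⟨hb4, hd⟩ | ⟨hb7, hd⟩
  · left
    refine ⟨hb4, ?_⟩
    rw [hS, Finset.sum_congr rfl (fun i hi => by rw [hd i (Finset.mem_range.1 hi)])]
    subst hb4
    decide
  · right
    refine ⟨hb7, ?_⟩
    have e3 : b - (1 + (b - 4)) = 3 := by omega
    have l1 : 1 < b := by omega
    have l2 : 2 < b := by omega
    have l0 : 0 < b := by omega
    conv_lhs => rw [hS, Finset.sum_congr rfl (fun i hi => by rw [hd i (Finset.mem_range.1 hi)])]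
    simp [add_mul, Finset.sum_add_distrib, ite_mul, e3, l0, l1, l2, Nat.sub_sub]
end

section
/- If b ≥ 2 and n is self-descriptive in base b, then every digit of n at a position i with 1 ≤ i ≤ b−1 (i.e., every digit except the leading one) is at most 2. -/
theorem nonleading_digits_le_two (b n : ℕ) (hb : 2 ≤ b) (h : IsSelfDescriptive b n) :
    ∀ i : ℕ, 1 ≤ i → i ≤ b - 1 → n / b ^ (b - 1 - i) % b ≤ 2 := by
  obtain ⟨hlen, hd⟩ := h
  intro j hj1 hj2
  set d : ℕ → ℕ := fun i => n / b ^ (b - 1 - i) % b with hddef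
  have hL : Nat.digits b n = (List.range b).map (fun k => n / b ^ k % b) := by
    apply List.ext_getElem
    · simp [hlen]
    · intro k h1 h2
      have := Nat.getD_digits n k hb
      rw [List.getD_eq_getElem _ _ h1] at this
      simp [this]
  have hsum : ∑ i ∈ Finset.range b, d i = b := by
    have h1 := Multiset.sum_count_eq_card (s := Finset.range b)
      (m := (Nat.digits b n : Multiset ℕ))
      (by intro a ha; simpa using Nat.digits_lt_base hb (by simpa using ha))
    rw [Multiset.coe_card, hlen] at h1
    refine Eq.trans ?_ h1
    apply Finset.sum_congr rfl
    intro i hi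
    rw [Multiset.coe_count]
    exact hd i (by simpa using hi)
  have hz : d 0 = ∑ i ∈ Finset.range b, if d i = 0 then 1 else 0 := by
    have h0 : d 0 = (Nat.digits b n).count 0 := hd 0 (by omega)
    rw [h0, hL]
    have := Finset.sum_range_reflect (fun k => if n / b ^ k % b = 0 then 1 else 0) b
    rw [show (∑ i ∈ Finset.range b, if d i = 0 then 1 else 0) = _ from this]
    have key : ∀ (f : ℕ → ℕ) (m : ℕ), ((List.range m).map f).count 0
        = ∑ k ∈ Finset.range m, if f k = 0 then 1 else 0 := by
      intro f m
      induction m with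
      | zero => simp
      | succ m ih =>
        rw [List.range_succ, List.map_append, List.count_append, ih, Finset.sum_range_succ]
        simp [List.count_singleton]
    exact key _ b
  have hcount : ∑ i ∈ Finset.range b, (d i + if d i = 0 then 1 else 0) = b + d 0 := by
    rw [Finset.sum_add_distrib, hsum, ← hz]
  have hm0 : 0 ∈ Finset.range b := by simp; omega
  have hmj : j ∈ (Finset.range b).erase 0 := by simp; omega
  rw [← Finset.add_sum_erase _ _ hm0, ← Finset.add_sum_erase _ _ hmj] at hcount
  have hge : ((Finset.range b).erase 0 |>.erase j).card • 1 ≤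
      ∑ i ∈ ((Finset.range b).erase 0).erase j, (d i + if d i = 0 then 1 else 0) := by
    apply Finset.card_nsmul_le_sum
    intro i _
    split_ifs <;> omega
  rw [Finset.card_erase_of_mem hmj, Finset.card_erase_of_mem hm0, Finset.card_range,
    smul_eq_mul, mul_one] at hge
  change d j ≤ 2
  omega
end
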